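/- Let A* be an (r−1)-connected (r > 1) Poincaré DGCA of degree n. If n ≤ 4r−2, then the l-th order Massey product of every Massey l-tuple is trivial for every l ≥ 3. If n ≤ 5r−3, then the l-th order Massey product of every Massey l-tuple is trivial for every l ≥ 4. -/

import Mathlib

universe u v

open scoped TensorProduct

/-- A (not necessarily commutative) differential graded algebra over `F`:
a nonnegatively graded, associative, unital `F`-algebra equipped with a degree `+1`
differential `d` satisfying `d ∘ d = 0` and the graded Leibniz rule. -/
structure DGA (F : Type u) (A : Type v) [Field F] [Ring A] [Algebra F A] where
  grading : ℤ → Submodule F A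
  internal : DirectSum.IsInternal grading
  nonneg : ∀ i : ℤ, i < 0 → grading i = ⊥
  one_mem : (1 : A) ∈ grading 0
  mul_mem : ∀ {i j : ℤ} {a b : A}, a ∈ grading i → b ∈ grading j → a * b ∈ grading (i + j)
  d : A →ₗ[F] A
  d_mem : ∀ {i : ℤ} {a : A}, a ∈ grading i → d a ∈ grading (i + 1)
  d_d : ∀ a : A, d (d a) = 0
  leibniz : ∀ {i : ℤ} (a b : A), a ∈ grading i →
    d (a * b) = d a * b + ((-1 : F) ^ i) • (a * d b)

namespace DGA

variable {F : Type u} {A : Type v} [Field F] [Ring A] [Algebra F A]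

/-- The cocycles of degree `k`. -/
def Zc (D : DGA F A) (k : ℤ) : Submodule F A := D.grading k ⊓ LinearMap.ker D.d

/-- The coboundaries of degree `k`. -/
def Bc (D : DGA F A) (k : ℤ) : Submodule F A := Submodule.map D.d (D.grading (k - 1))

/-- `a` is exact, i.e. a coboundary. -/
def IsExact (D : DGA F A) (a : A) : Prop := ∃ b, a = D.d b

/-- Two elements define the same cohomology class. -/
def Cohomologous (D : DGA F A) (a b : A) : Prop := ∃ c, a - b = D.d c

/-- `H^0 = F·[1]`. -/
def Connected (D : DGA F A) : Prop :=
  ∀ a ∈ D.grading 0, D.d a = 0 → ∃ c : F, a = c • (1 : A)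

/-- Connected and `H^k = 0` for `1 ≤ k ≤ r`.  An `(r-1)`-connected DGA in the sense of
the paper is one satisfying `RConnected (r-1)`. -/
def RConnected (D : DGA F A) (r : ℤ) : Prop :=
  D.Connected ∧ ∀ k : ℤ, 1 ≤ k → k ≤ r → ∀ a ∈ D.grading k, D.d a = 0 → D.IsExact a

/-- A harmonic subspace: a graded complement of the coboundaries inside the cocycles. -/
def IsHarmonicFamily (D : DGA F A) (H : ℤ → Submodule F A) : Prop :=
  ∀ k : ℤ, H k ≤ D.Zc k ∧ Disjoint (D.Bc k) (H k) ∧ D.Zc k ≤ D.Bc k ⊔ H k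

/-- The operator `d⁻` attached to a decomposition `A = dA ⊕ H ⊕ B`: the inverse of
`d : B → dA` extended by `0` on `H ⊕ B`. -/
def IsDminus (D : DGA F A) (H B : ℤ → Submodule F A) (dm : A →ₗ[F] A) : Prop :=
  (∀ k : ℤ, ∀ b ∈ B k, dm (D.d b) = b) ∧
  (∀ k : ℤ, ∀ h ∈ H k, dm h = 0) ∧
  (∀ k : ℤ, ∀ b ∈ B k, dm b = 0) ∧
  (∀ k : ℤ, ∀ a ∈ D.grading k, dm a ∈ B (k - 1))

/-- The projection `π_H : A → H` with kernel `dA ⊕ B`. -/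
def IsHarmonicProj (D : DGA F A) (H B : ℤ → Submodule F A) (pH : A →ₗ[F] A) : Prop :=
  (∀ k : ℤ, ∀ h ∈ H k, pH h = h) ∧
  (∀ k : ℤ, ∀ b ∈ B k, pH b = 0) ∧
  (∀ a : A, pH (D.d a) = 0) ∧
  (∀ k : ℤ, ∀ a ∈ D.grading k, pH a ∈ H k)

/-- The degree of the entry `a i j` of a defining system: `|x_i| + ⋯ + |x_j| - (j - i)`. -/
def degSum (deg : ℕ → ℤ) (i j : ℕ) : ℤ :=
  (∑ t ∈ Finset.Icc i j, deg t) - ((j - i : ℕ) : ℤ)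

/-- A defining system for the `l`-th order Massey product of the classes of the
cocycles `x 1, …, x l` (of degrees `deg 1, …, deg l`). -/
def IsDefiningSystem (D : DGA F A) (l : ℕ) (deg : ℕ → ℤ) (x : ℕ → A)
    (a : ℕ → ℕ → A) : Prop :=
  (∀ i : ℕ, 1 ≤ i → i ≤ l →
      a i i ∈ D.grading (deg i) ∧ D.d (a i i) = 0 ∧ D.Cohomologous (a i i) (x i)) ∧
  (∀ i j : ℕ, 1 ≤ i → i ≤ j → j ≤ l → a i j ∈ D.grading (degSum deg i j)) ∧
  (∀ i j : ℕ, 1 ≤ i → i < j → j ≤ l → ¬(i = 1 ∧ j = l) →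
    D.d (a i j) = ∑ k ∈ Finset.Ico i j, ((-1 : F) ^ degSum deg i k) • (a i k * a (k + 1) j))

/-- The cocycle `∑ ā_{1k} a_{k+1,l}` produced by a defining system. -/
def masseyOut (D : DGA F A) (l : ℕ) (deg : ℕ → ℤ) (a : ℕ → ℕ → A) : A :=
  ∑ k ∈ Finset.Ico 1 l, ((-1 : F) ^ degSum deg 1 k) • (a 1 k * a (k + 1) l)

/-- `(x 1, …, x l)` is a Massey `l`-tuple: the Massey product is nonempty. -/
def IsMasseyTuple (D : DGA F A) (l : ℕ) (deg : ℕ → ℤ) (x : ℕ → A) : Prop :=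
  (∀ i : ℕ, 1 ≤ i → i ≤ l → x i ∈ D.Zc (deg i)) ∧ ∃ a, D.IsDefiningSystem l deg x a

/-- The `l`-th order Massey product of `(x 1, …, x l)` is trivial: it contains `0`. -/
def MasseyTrivial (D : DGA F A) (l : ℕ) (deg : ℕ → ℤ) (x : ℕ → A) : Prop :=
  ∃ a, D.IsDefiningSystem l deg x a ∧ D.IsExact (D.masseyOut l deg a)

end DGA

/-- A differential graded commutative algebra (DGCA) over `F`. -/
structure DGCA (F : Type u) (A : Type v) [Field F] [Ring A] [Algebra F A]
    extends DGA F A where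
  gcomm : ∀ {i j : ℤ} (a b : A), a ∈ grading i → b ∈ grading j →
    a * b = ((-1 : F) ^ (i * j)) • (b * a)

/-- A Poincaré DGCA of degree `n`: a DGCA concentrated in degrees `0, …, n`, with finite
dimensional cohomology, equipped with a linear functional `∫` (given here as `intg`, a
functional on `A` vanishing in degrees `≠ n` and on coboundaries) such that the induced
pairing `⟨a, b⟩ = ∫ [a * b]` is nondegenerate on cohomology. -/
structure PoincareDGCA (F : Type u) (A : Type v) [Field F] [Ring A] [Algebra F A]
    (n : ℤ) extends DGCA F A where
  top : ∀ i : ℤ, n < i → grading i = ⊥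
  fin_cohomology : ∀ k : ℤ, ∃ W : Submodule F A, FiniteDimensional F W ∧
    ∀ a ∈ grading k, d a = 0 → ∃ w ∈ W, ∃ c, a - w = d c
  intg : A →ₗ[F] F
  intg_deg : ∀ i : ℤ, i ≠ n → ∀ a ∈ grading i, intg a = 0
  intg_d : ∀ a : A, intg (d a) = 0
  nondeg : ∀ i : ℤ, ∀ a ∈ grading i, d a = 0 →
    (∀ b ∈ grading (n - i), d b = 0 → intg (a * b) = 0) → ∃ c, a = d c

namespace PoincareDGCA

variable {F : Type u} {A : Type v} [Field F] [Ring A] [Algebra F A] {n : ℤ}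

/-- The null space `A⊥` of the induced pairing `⟨a, b⟩ = ∫ (a * b)` on `A`. -/
def perp (P : PoincareDGCA F A n) : Submodule F A :=
  ⨅ b : A, LinearMap.ker (P.intg ∘ₗ LinearMap.mulRight F b)

/-- `A = dA ⊕ H ⊕ B` is a Hodge type decomposition: `H` is a harmonic subspace,
`B` is a graded complement, and `⟨H ⊕ B, B⟩ = 0`. -/
def IsHodge (P : PoincareDGCA F A n) (H B : ℤ → Submodule F A) : Prop :=
  P.toDGA.IsHarmonicFamily H ∧
  (∀ k : ℤ, B k ≤ P.grading k) ∧
  (∀ k : ℤ, Disjoint (P.toDGA.Bc k ⊔ H k) (B k)) ∧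
  (∀ k : ℤ, P.grading k ≤ P.toDGA.Bc k ⊔ H k ⊔ B k) ∧
  (∀ j k : ℤ, ∀ a ∈ H j ⊔ B j, ∀ b ∈ B k, P.intg (a * b) = 0)

/-- A Poincaré DGCA of Hodge type: one admitting a Hodge type decomposition. -/
def HodgeType (P : PoincareDGCA F A n) : Prop := ∃ H B, P.IsHodge H B

end PoincareDGCA

/-- A bundled DGCA over `F`. -/
structure BDGCA (F : Type u) [Field F] : Type (max (u + 1) (v + 1)) where
  carrier : Type v
  [ringInst : Ring carrier]
  [algInst : Algebra F carrier]
  str : DGCA F carrier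

attribute [instance] BDGCA.ringInst BDGCA.algInst

/-- A morphism of DGCAs: an algebra homomorphism preserving the grading and
commuting with the differentials. -/
structure DGCAHom {F : Type u} [Field F] (X Y : BDGCA.{u, v} F) where
  f : X.carrier →ₐ[F] Y.carrier
  map_grading : ∀ i : ℤ, ∀ a ∈ X.str.grading i, f a ∈ Y.str.grading i
  map_d : ∀ a, f (X.str.d a) = Y.str.d (f a)

/-- A quasi-isomorphism: a DGCA morphism inducing an isomorphism on cohomology. -/
def DGCAHom.QuasiIso {F : Type u} [Field F] {X Y : BDGCA.{u, v} F}
    (φ : DGCAHom X Y) : Prop :=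
  (∀ i : ℤ, ∀ a ∈ X.str.grading i, X.str.d a = 0 →
    (∃ b, φ.f a = Y.str.d b) → ∃ c, a = X.str.d c) ∧
  (∀ i : ℤ, ∀ a' ∈ Y.str.grading i, Y.str.d a' = 0 →
    ∃ a ∈ X.str.grading i, X.str.d a = 0 ∧ ∃ b, φ.f a - a' = Y.str.d b)

/-- Two DGCAs are equivalent if they are joined by a finite zig-zag of
quasi-isomorphisms. -/
def DGCAEquivalent {F : Type u} [Field F] : BDGCA.{u, v} F → BDGCA.{u, v} F → Prop :=
  Relation.EqvGen fun X Y => ∃ φ : DGCAHom X Y, φ.QuasiIso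

/-- A DGCA is formal if it is equivalent to a DGCA with zero differential
(equivalently, to its cohomology with the zero differential). -/
def DGCAFormal {F : Type u} [Field F] (X : BDGCA.{u, v} F) : Prop :=
  ∃ Y : BDGCA.{u, v} F, Y.str.d = 0 ∧ DGCAEquivalent X Y

namespace DGA

variable {F : Type u} {A : Type v} [Field F] [Ring A] [Algebra F A]

lemma degSum_self (deg : ℕ → ℤ) (i : ℕ) : degSum deg i i = deg i := by
  simp [degSum]

lemma degSum_add_degSum (deg : ℕ → ℤ) {i k j : ℕ} (hik : i ≤ k) (hkj : k < j) :
    degSum deg i k + degSum deg (k + 1) j = degSum deg i j + 1 := by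
  have h : ∑ t ∈ Finset.Icc i j, deg t =
      ∑ t ∈ Finset.Icc i k, deg t + ∑ t ∈ Finset.Icc (k + 1) j, deg t := by
    simp only [← Finset.Ico_add_one_right_eq_Icc]
    exact (Finset.sum_Ico_consecutive deg (by omega) (by omega)).symm
  simp only [degSum, h]
  omega

lemma neg_one_zpow_mul_self (m : ℤ) : (-1 : F) ^ m * (-1 : F) ^ m = 1 := by
  rw [← mul_zpow]
  simp

lemma neg_one_zpow_degSum (deg : ℕ → ℤ) {i k j : ℕ} (hik : i ≤ k) (hkj : k < j) :
    (-1 : F) ^ degSum deg i j * (-1 : F) ^ degSum deg i k =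
      -(-1 : F) ^ degSum deg (k + 1) j := by
  have h : degSum deg i j = degSum deg i k + degSum deg (k + 1) j - 1 := by
    have := degSum_add_degSum deg hik hkj
    omega
  rw [h, zpow_sub_one₀ (by simp), zpow_add₀ (by simp)]
  linear_combination (-(-1 : F) ^ degSum deg (k + 1) j) *
    neg_one_zpow_mul_self (F := F) (degSum deg i k) +
    (-1 : F) ^ degSum deg i k * (-1 : F) ^ degSum deg (k + 1) j *
      (-1 : F) ^ degSum deg i k * (by norm_num : (-1 : F)⁻¹ = -1)

variable {D : DGA F A} {l : ℕ} {deg : ℕ → ℤ} {x : ℕ → A} {a : ℕ → ℕ → A}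

lemma isExact_zero (D : DGA F A) : D.IsExact 0 := ⟨0, by simp⟩

lemma isExact_of_smul {c : F} (hc : c ≠ 0) {y : A} (h : D.IsExact (c • y)) :
    D.IsExact y := by
  obtain ⟨b, hb⟩ := h
  exact ⟨c⁻¹ • b, by rw [map_smul, ← hb, smul_smul, inv_mul_cancel₀ hc, one_smul]⟩

/-- The differential of a diagonal entry is given by the same formula, with an empty sum. -/
lemma IsDefiningSystem.d_entry (ha : D.IsDefiningSystem l deg x a) {i j : ℕ} (hi : 1 ≤ i)
    (hij : i ≤ j) (hj : j ≤ l) (hne : ¬(i = 1 ∧ j = l)) :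
    D.d (a i j) =
      ∑ k ∈ Finset.Ico i j, ((-1 : F) ^ degSum deg i k) • (a i k * a (k + 1) j) := by
  rcases hij.eq_or_lt with rfl | h
  · simpa using (ha.1 i hi hj).2.1
  · exact ha.2.2 i j hi h hj hne

lemma IsDefiningSystem.masseyOut_mem (ha : D.IsDefiningSystem l deg x a) :
    D.masseyOut l deg a ∈ D.grading (degSum deg 1 l + 1) := by
  refine Submodule.sum_mem _ fun k hk => Submodule.smul_mem _ _ ?_
  rw [Finset.mem_Ico] at hk
  rw [← degSum_add_degSum deg hk.1 hk.2]
  exact D.mul_mem (ha.2.1 1 k le_rfl hk.1 hk.2.le) (ha.2.1 (k + 1) l (by omega) hk.2 le_rfl)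

lemma IsDefiningSystem.d_masseyOut (ha : D.IsDefiningSystem l deg x a) :
    D.d (D.masseyOut l deg a) = 0 := by
  have key : ∀ k ∈ Finset.Ico 1 l,
      D.d (((-1 : F) ^ degSum deg 1 k) • (a 1 k * a (k + 1) l)) =
        (∑ j ∈ Finset.Ico 1 k,
          -(((-1 : F) ^ degSum deg (j + 1) k) • (a 1 j * a (j + 1) k * a (k + 1) l))) +
        ∑ j ∈ Finset.Ico (k + 1) l,
          ((-1 : F) ^ degSum deg (k + 1) j) • (a 1 k * a (k + 1) j * a (j + 1) l) := by
    intro k hk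
    rw [Finset.mem_Ico] at hk
    rw [map_smul, D.leibniz _ _ (ha.2.1 1 k le_rfl hk.1 hk.2.le),
      ha.d_entry le_rfl hk.1 hk.2.le (by omega),
      ha.d_entry (i := k + 1) (by omega) hk.2 le_rfl (by omega), smul_add, smul_smul,
      neg_one_zpow_mul_self, one_smul, Finset.sum_mul, Finset.mul_sum, Finset.smul_sum]
    congr 1
    · refine Finset.sum_congr rfl fun j hj => ?_
      rw [Finset.mem_Ico] at hj
      rw [smul_mul_assoc, smul_smul, neg_one_zpow_degSum deg hj.1 hj.2, neg_smul]
    · refine Finset.sum_congr rfl fun j _ => ?_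
      rw [mul_smul_comm, mul_assoc]
  rw [masseyOut, map_sum, Finset.sum_congr rfl key, Finset.sum_add_distrib,
    ← Finset.sum_Ico_Ico_comm', ← Finset.sum_add_distrib]
  refine Finset.sum_eq_zero fun j _ => ?_
  rw [← Finset.sum_add_distrib]
  exact Finset.sum_eq_zero fun k _ => neg_add_cancel _

/-- If one of the classes vanishes, the Massey product contains `0`. -/
lemma IsDefiningSystem.masseyTrivial_of_isExact (ha : D.IsDefiningSystem l deg x a) {i : ℕ}
    (hi : 1 ≤ i) (hil : i ≤ l) (h : D.IsExact (a i i)) : D.MasseyTrivial l deg x := by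
  refine ⟨fun p q => if p ≤ i ∧ i ≤ q then 0 else a p q, ⟨?_, ?_, ?_⟩, ?_⟩
  · intro p hp hpl
    by_cases hpi : p = i
    · subst hpi
      obtain ⟨b, hb⟩ := h
      obtain ⟨c, hc⟩ := (ha.1 p hp hpl).2.2
      refine ⟨by simp, by simp, c - b, ?_⟩
      simp [← hc, ← hb]
    · have hn : ¬(p ≤ i ∧ i ≤ p) := by omega
      simpa only [if_neg hn] using ha.1 p hp hpl
  · intro p q hp hpq hq
    dsimp only
    split_ifs
    · exact Submodule.zero_mem _
    · exact ha.2.1 p q hp hpq hq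
  · intro p q hp hpq hq hne
    dsimp only
    split_ifs with hi'
    · rw [map_zero]
      refine (Finset.sum_eq_zero fun k hk => ?_).symm
      rw [Finset.mem_Ico] at hk
      by_cases hik : i ≤ k
      · rw [if_pos ⟨hi'.1, hik⟩, zero_mul, smul_zero]
      · rw [if_pos (c := k + 1 ≤ i ∧ i ≤ q) ⟨by omega, hi'.2⟩, mul_zero, smul_zero]
    · rw [ha.2.2 p q hp hpq hq hne]
      refine Finset.sum_congr rfl fun k hk => ?_
      rw [Finset.mem_Ico] at hk
      rw [if_neg (by omega), if_neg (by omega)]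
  · convert D.isExact_zero
    refine Finset.sum_eq_zero fun k hk => ?_
    rw [Finset.mem_Ico] at hk
    beta_reduce
    by_cases hik : i ≤ k
    · rw [if_pos ⟨hi, hik⟩, zero_mul, smul_zero]
    · rw [if_pos (c := k + 1 ≤ i ∧ i ≤ l) ⟨by omega, hil⟩, mul_zero, smul_zero]

/-- A degree `0` factor forces one of the classes to vanish when `H⁰ = F·[1]`. -/
lemma IsDefiningSystem.exists_isExact_of_deg_eq_zero (ha : D.IsDefiningSystem l deg x a)
    (hconn : D.Connected) (hl : 3 ≤ l) {i : ℕ} (hi : 1 ≤ i) (hil : i ≤ l)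
    (h : deg i = 0) : ∃ j, 1 ≤ j ∧ j ≤ l ∧ D.IsExact (a j j) := by
  obtain ⟨hmem, hd, -⟩ := ha.1 i hi hil
  rw [h] at hmem
  obtain ⟨c, hc⟩ := hconn _ hmem hd
  by_cases hc0 : c = 0
  · exact ⟨i, hi, hil, by simpa [hc, hc0] using D.isExact_zero⟩
  have hsign : ∀ m : ℤ, (-1 : F) ^ m * c ≠ 0 := fun m =>
    mul_ne_zero (zpow_ne_zero _ (by simp)) hc0
  rcases hil.eq_or_lt with rfl | hil'
  · obtain ⟨m, rfl⟩ : ∃ m, i = m + 1 := ⟨i - 1, by omega⟩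
    refine ⟨m, by omega, by omega,
      isExact_of_smul (hsign (degSum deg m m)) ⟨a m (m + 1), ?_⟩⟩
    rw [ha.2.2 m (m + 1) (by omega) (by omega) le_rfl (by omega)]
    simp [hc, smul_smul]
  · refine ⟨i + 1, by omega, hil',
      isExact_of_smul (hsign (degSum deg i i)) ⟨a i (i + 1), ?_⟩⟩
    rw [ha.2.2 i (i + 1) hi (by omega) hil' (by omega)]
    simp [hc, smul_smul]

lemma IsDefiningSystem.masseyTrivial_or_le_deg (ha : D.IsDefiningSystem l deg x a) {r : ℤ}
    (hconn : D.RConnected (r - 1)) (hl : 3 ≤ l) :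
    D.MasseyTrivial l deg x ∨ ∀ i, 1 ≤ i → i ≤ l → r ≤ deg i ∧ ¬ D.IsExact (a i i) := by
  refine or_iff_not_imp_left.2 fun hM i hi hil => ?_
  have hne : ¬ D.IsExact (a i i) := fun h => hM (ha.masseyTrivial_of_isExact hi hil h)
  refine ⟨?_, hne⟩
  by_contra! hlt
  obtain ⟨hmem, hd, -⟩ := ha.1 i hi hil
  rcases lt_trichotomy (deg i) 0 with h | h | h
  · rw [D.nonneg _ h, Submodule.mem_bot] at hmem
    exact hne (hmem ▸ D.isExact_zero)
  · obtain ⟨j, hj, hjl, hex⟩ := ha.exists_isExact_of_deg_eq_zero hconn.1 hl hi hil h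
    exact hM (ha.masseyTrivial_of_isExact hj hjl hex)
  · exact hne (hconn.2 _ (by omega) (by omega) _ hmem hd)

lemma le_degSum_of_le {r : ℤ} (h : ∀ i, 1 ≤ i → i ≤ l → r ≤ deg i) (hl : 1 ≤ l) :
    (l : ℤ) * (r - 1) + 1 ≤ degSum deg 1 l := by
  have := Finset.card_nsmul_le_sum (Finset.Icc 1 l) deg r fun i hi =>
    h i (Finset.mem_Icc.1 hi).1 (Finset.mem_Icc.1 hi).2
  rw [Nat.card_Icc, Nat.add_sub_cancel, nsmul_eq_mul] at this
  rw [degSum, Nat.cast_sub hl]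
  push_cast
  linarith

/-- The entry `a 2 l` of a defining system may be changed by any cocycle of the right degree. -/
lemma IsDefiningSystem.add_cocycle (ha : D.IsDefiningSystem l deg x a) (hl : 3 ≤ l) {z : A}
    (hz : z ∈ D.grading (degSum deg 2 l)) (hdz : D.d z = 0) :
    ∃ a', D.IsDefiningSystem l deg x a' ∧
      D.masseyOut l deg a' =
        D.masseyOut l deg a + ((-1 : F) ^ degSum deg 1 1) • (a 1 1 * z) := by
  have hne : ∀ p q, ¬(p = 2 ∧ q = l) → (a p q + if p = 2 ∧ q = l then z else 0) = a p q :=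
    fun p q h => by rw [if_neg h, add_zero]
  refine ⟨fun p q => a p q + if p = 2 ∧ q = l then z else 0, ⟨?_, ?_, ?_⟩, ?_⟩
  · intro p hp hpl
    simpa only [hne p p (by omega)] using ha.1 p hp hpl
  · intro p q hp hpq hq
    refine Submodule.add_mem _ (ha.2.1 p q hp hpq hq) ?_
    split_ifs with h
    · rwa [h.1, h.2]
    · exact Submodule.zero_mem _
  · intro p q hp hpq hq h1
    have h0 : D.d (if p = 2 ∧ q = l then z else 0) = 0 := by
      split_ifs <;> simp [hdz]
    rw [map_add, h0, add_zero, ha.2.2 p q hp hpq hq h1]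
    refine Finset.sum_congr rfl fun k hk => ?_
    rw [Finset.mem_Ico] at hk
    beta_reduce
    rw [hne p k (by omega), hne (k + 1) q (by omega)]
  · rw [masseyOut, masseyOut, Finset.sum_eq_sum_Ico_succ_bot (by omega),
      Finset.sum_eq_sum_Ico_succ_bot (by omega : 1 < l), hne 1 1 (by omega), if_pos ⟨rfl, rfl⟩,
      mul_add, smul_add, add_right_comm]
    congr 2
    refine Finset.sum_congr rfl fun k hk => ?_
    rw [Finset.mem_Ico] at hk
    rw [hne 1 k (by omega), hne (k + 1) l (by omega)]

end DGA

namespace PoincareDGCA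

variable {F : Type u} {A : Type v} [Field F] [Ring A] [Algebra F A] {n : ℤ}

/-- A cocycle of top degree with vanishing integral is exact. -/
lemma isExact_of_intg_eq_zero (P : PoincareDGCA F A n) (hconn : P.toDGA.Connected) {y : A}
    (hy : y ∈ P.grading n) (hd : P.d y = 0) (h0 : P.intg y = 0) : P.toDGA.IsExact y := by
  refine P.nondeg n y hy hd fun b hb hdb => ?_
  rw [sub_self] at hb
  obtain ⟨c, rfl⟩ := hconn b hb hdb
  simp [h0]

/-- By Poincaré duality, an `(r-1)`-connected algebra has `H^m = 0` for `n - r < m`, `m ≠ n`. -/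
lemma isExact_of_lt (P : PoincareDGCA F A n) {r m : ℤ} (hconn : P.toDGA.RConnected (r - 1))
    (hm : n - r < m) (hmn : m ≠ n) {y : A} (hy : y ∈ P.grading m) (hd : P.d y = 0) :
    P.toDGA.IsExact y := by
  refine P.nondeg m y hy hd fun b hb hdb => ?_
  rcases lt_or_gt_of_ne (sub_ne_zero.2 hmn.symm) with h | h
  · rw [P.nonneg _ h, Submodule.mem_bot] at hb
    simp [hb]
  · obtain ⟨c, rfl⟩ := hconn.2 (n - m) (by omega) (by omega) b hb hdb
    have hint := P.intg_d (y * c)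
    rw [P.leibniz y c hy, hd, zero_mul, zero_add, map_smul, smul_eq_mul] at hint
    exact (mul_eq_zero.1 hint).resolve_left (zpow_ne_zero _ (by simp))

lemma masseyTrivial_of_le (P : PoincareDGCA F A n) {r : ℤ}
    (hconn : P.toDGA.RConnected (r - 1)) {l : ℕ} (hl : 3 ≤ l)
    (hn : n ≤ r + (l : ℤ) * (r - 1) + 1) {deg : ℕ → ℤ} {x : ℕ → A}
    (hx : P.toDGA.IsMasseyTuple l deg x) : P.toDGA.MasseyTrivial l deg x := by
  obtain ⟨-, a, ha⟩ := hx
  rcases ha.masseyTrivial_or_le_deg hconn hl with h | hdeg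
  · exact h
  have hlow := DGA.le_degSum_of_le (fun i hi hil => (hdeg i hi hil).1) (by omega : 1 ≤ l)
  by_cases hmn : DGA.degSum deg 1 l + 1 = n
  · obtain ⟨hmem, hd, -⟩ := ha.1 1 le_rfl (by omega)
    obtain ⟨b, hb, hdb, hab⟩ : ∃ b ∈ P.grading (n - deg 1), P.d b = 0 ∧
        P.intg (a 1 1 * b) ≠ 0 := by
      by_contra! h
      exact (hdeg 1 le_rfl (by omega)).2 (P.nondeg _ _ hmem hd h)
    have h2 : DGA.degSum deg 2 l = n - deg 1 := by
      have := DGA.degSum_add_degSum deg (le_refl 1) (by omega : 1 < l)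
      rw [DGA.degSum_self] at this
      norm_num at this
      omega
    have hs : (-1 : F) ^ DGA.degSum deg 1 1 ≠ 0 := zpow_ne_zero _ (by simp)
    set c : F := -(P.intg (P.masseyOut l deg a)) /
      ((-1 : F) ^ DGA.degSum deg 1 1 * P.intg (a 1 1 * b)) with hc
    obtain ⟨a', ha', hout⟩ := ha.add_cocycle hl (z := c • b)
      (h2 ▸ Submodule.smul_mem _ _ hb) (by rw [map_smul, hdb, smul_zero])
    refine ⟨a', ha', P.isExact_of_intg_eq_zero hconn.1 (hmn ▸ ha'.masseyOut_mem)
      ha'.d_masseyOut ?_⟩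
    rw [hout, mul_smul_comm, map_add, map_smul, map_smul, smul_eq_mul, smul_eq_mul, hc]
    field_simp
    ring
  · exact ⟨a, ha, P.isExact_of_lt hconn (by linarith) hmn ha.masseyOut_mem ha.d_masseyOut⟩

end PoincareDGCA

/-- Let `A*` be an `(r-1)`-connected (`r > 1`) Poincaré DGCA of degree
`n`.  If `n ≤ 4r-2`, all Massey products of order `l ≥ 3` are trivial; if `n ≤ 5r-3`,
all Massey products of order `l ≥ 4` are trivial. -/
theorem statement_19 {F : Type u} {A : Type v} [Field F] [Ring A] [Algebra F A] {n : ℤ}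
    (P : PoincareDGCA F A n) (r : ℤ) (hr : 1 < r)
    (hconn : P.toDGA.RConnected (r - 1)) :
    (n ≤ 4 * r - 2 →
      ∀ l : ℕ, 3 ≤ l → ∀ (deg : ℕ → ℤ) (x : ℕ → A),
        P.toDGA.IsMasseyTuple l deg x → P.toDGA.MasseyTrivial l deg x) ∧
    (n ≤ 5 * r - 3 →
      ∀ l : ℕ, 4 ≤ l → ∀ (deg : ℕ → ℤ) (x : ℕ → A),
        P.toDGA.IsMasseyTuple l deg x → P.toDGA.MasseyTrivial l deg x) := by
  refine ⟨fun hn l hl deg x hx => P.masseyTrivial_of_le hconn hl ?_ hx,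
    fun hn l hl deg x hx => P.masseyTrivial_of_le hconn (by omega) ?_ hx⟩
  · have h : (3 : ℤ) ≤ l := by exact_mod_cast hl
    nlinarith
  · have h : (4 : ℤ) ≤ l := by exact_mod_cast hl
    nlinarith
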